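/- arXiv:2104.04861 — 2 statements merged into one kernel-verified Lean document; each statement's English description precedes it below -/
import Mathlib

section
/- Let G be a finite group, M a subnormal subgroup of G, χ an irreducible character of G, and φ an irreducible constituent of the restriction χ|_M. Then cod(φ) divides cod(χ). -/
open CategoryTheory Module

/-- The kernel of (the character of) a finite-dimensional complex representation. -/
noncomputable def FDRep.charKer {G : Type} [Group G] (V : FDRep ℂ G) : Subgroup G :=
  MonoidHom.ker (Representation.asGroupHom V.ρ)

/-- The codegree `|G : ker χ| / χ(1)` of an irreducible complex character. -/
noncomputable def FDRep.codegree {G : Type} [Group G] (V : FDRep ℂ G) : ℕ :=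
  V.charKer.index / finrank ℂ V

/-- The set of codegrees of the irreducible complex characters of `G`. -/
noncomputable def codSet (G : Type) [Group G] : Set ℕ :=
  {n | ∃ V : FDRep ℂ G, Simple V ∧ V.codegree = n}

attribute [local instance] Classical.propDecidable

/-- `M` is a subnormal subgroup of `G`: there is a chain `M = M₀ ⊴ M₁ ⊴ ⋯ ⊴ Mₖ = G`. -/
def Subgroup.IsSubnormalIn {G : Type*} [Group G] (M : Subgroup G) : Prop :=
  ∃ (n : ℕ) (c : Fin (n + 1) → Subgroup G), c 0 = M ∧ c (Fin.last n) = ⊤ ∧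
    ∀ i : Fin n, c i.castSucc ≤ c i.succ ∧ ((c i.castSucc).subgroupOf (c i.succ)).Normal


namespace CodAux

open LinearMap

/-- Elementary irreducibility. -/
def Irr {G V : Type*} [Group G] [AddCommGroup V] [Module ℂ V] (ρ : Representation ℂ G V) : Prop :=
  Nontrivial V ∧ ∀ X : Submodule ℂ V, (∀ g, ∀ x ∈ X, ρ g x ∈ X) → X = ⊥ ∨ X = ⊤

theorem schur {G V : Type*} [Group G] [AddCommGroup V] [Module ℂ V] [FiniteDimensional ℂ V]
    {ρ : Representation ℂ G V} (h : Irr ρ) (T : Module.End ℂ V) (hT : ∀ g, T * ρ g = ρ g * T) :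
    ∃ c : ℂ, T = c • (1 : Module.End ℂ V) := by
  have := h.1
  obtain ⟨c, hc⟩ := Module.End.exists_eigenvalue T
  refine ⟨c, ?_⟩
  have h2 := h.2 (Module.End.eigenspace T c) (by
    intro g x hx
    rw [Module.End.mem_eigenspace_iff] at hx ⊢
    have := LinearMap.congr_fun (hT g) x
    simp only [Module.End.mul_apply] at this
    rw [this, hx, map_smul])
  rcases h2 with h2 | h2
  · exact absurd h2 hc
  · ext x
    have : x ∈ Module.End.eigenspace T c := by rw [h2]; trivial
    rw [Module.End.mem_eigenspace_iff] at this
    simpa using this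

theorem schur_trace {G V : Type*} [Group G] [AddCommGroup V] [Module ℂ V] [FiniteDimensional ℂ V]
    {ρ : Representation ℂ G V} (h : Irr ρ) (T : Module.End ℂ V) (hT : ∀ g, T * ρ g = ρ g * T) :
    T = (LinearMap.trace ℂ V T / finrank ℂ V) • (1 : Module.End ℂ V) := by
  obtain ⟨c, rfl⟩ := schur h T hT
  have := h.1
  have : (finrank ℂ V : ℂ) ≠ 0 := by exact_mod_cast (finrank_pos (R := ℂ) (M := V)).ne'
  congr 1
  rw [map_smul, LinearMap.trace_one, smul_eq_mul]
  field_simp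

/-- trace of a finite order operator is an algebraic integer -/
theorem isIntegral_trace_of_pow {V : Type*} [AddCommGroup V] [Module ℂ V] [FiniteDimensional ℂ V]
    (T : Module.End ℂ V) (m : ℕ) (hm : 0 < m) (hT : T ^ m = 1) :
    IsIntegral ℤ (LinearMap.trace ℂ V T) := by
  have hs : T.charpoly.Splits := IsAlgClosed.splits _
  rw [Module.End.trace_eq_sum_roots_charpoly_of_splits hs]
  refine IsIntegral.multiset_sum ?_
  intro c hc
  have hc' : Module.End.HasEigenvalue T c := by
    rw [Module.End.hasEigenvalue_iff_isRoot_charpoly]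
    exact Polynomial.isRoot_of_mem_roots hc
  obtain ⟨v, hv⟩ := hc'.exists_hasEigenvector
  have h1 := hv.pow_apply m
  rw [hT, Module.End.one_apply] at h1
  have h2 : c ^ m = 1 := by
    have h3 : (c ^ m - 1) • v = 0 := by rw [sub_smul, ← h1, one_smul, sub_self]
    rcases smul_eq_zero.1 h3 with h | h
    · exact sub_eq_zero.1 h
    · exact absurd h hv.2
  refine IsIntegral.of_pow hm ?_
  rw [h2]; exact isIntegral_one

section twist
variable {G W : Type*} [Group G] {N : Subgroup G} [N.Normal] [AddCommGroup W] [Module ℂ W]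

/-- `X` intertwines `σ` with its conjugate by `r`. -/
def Twist (σ : Representation ℂ N W) (r : G) (X : Module.End ℂ W) : Prop :=
  ∀ n : N, X * σ n = σ (MulAut.conjNormal r n) * X

variable {σ : Representation ℂ N W}

theorem Twist.mul {r s : G} {X Y : Module.End ℂ W} (hX : Twist σ r X) (hY : Twist σ s Y) :
    Twist σ (r * s) (X * Y) := by
  intro n
  rw [mul_assoc, hY n, ← mul_assoc, hX, map_mul, MulAut.mul_apply, mul_assoc]

theorem Twist.one : Twist σ 1 1 := by intro n; simp

theorem Twist.pow {r : G} {X : Module.End ℂ W} (hX : Twist σ r X) (k : ℕ) :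
    Twist σ (r ^ k) (X ^ k) := by
  induction k with
  | zero => simpa using Twist.one
  | succ k ih => rw [pow_succ, pow_succ]; exact ih.mul hX

theorem Twist.smul {r : G} {X : Module.End ℂ W} (hX : Twist σ r X) (c : ℂ) : Twist σ r (c • X) := by
  intro n
  rw [smul_mul_assoc, hX n, mul_smul_comm]

theorem twist_self (n : N) : Twist σ (n : G) (σ n) := by
  intro m
  rw [← map_mul, ← map_mul]
  congr 1
  ext
  simp [MulAut.conjNormal_apply]

theorem Twist.inv {r : G} {X Y : Module.End ℂ W} (hX : Twist σ r X) (h1 : X * Y = 1) (h2 : Y * X = 1) :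
    Twist σ r⁻¹ Y := by
  intro n
  have h := hX (MulAut.conjNormal r⁻¹ n)
  rw [← MulAut.mul_apply, ← map_mul, mul_inv_cancel, map_one, MulAut.one_apply] at h
  calc Y * σ n = Y * (σ n * X) * Y := by rw [mul_assoc, mul_assoc, h1, mul_one]
    _ = _ := by rw [← h, ← mul_assoc, h2, one_mul]

variable [FiniteDimensional ℂ W]

theorem twist_scalar (h : Irr σ) {X : Module.End ℂ W} (hX : Twist σ 1 X) :
    X = (LinearMap.trace ℂ W X / finrank ℂ W) • (1 : Module.End ℂ W) := by
  apply schur_trace h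
  intro n
  simpa using hX n

theorem twist_dichotomy (h : Irr σ) (r : G) :
    ∃ a a' : Module.End ℂ W, (a = 0 ∧ a' = 0 ∧ ∀ X, Twist σ r⁻¹ X → X = 0) ∨
      (Twist σ r a ∧ Twist σ r⁻¹ a' ∧ a * a' = 1 ∧ a' * a = 1 ∧ LinearMap.det a = 1) := by
  by_cases hh : ∀ X, Twist σ r⁻¹ X → X = 0
  · exact ⟨0, 0, Or.inl ⟨rfl, rfl, hh⟩⟩
  push Not at hh
  obtain ⟨X, hX, hX0⟩ := hh
  have hker : LinearMap.ker X = ⊥ := by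
    rcases h.2 (LinearMap.ker X) (by
      intro n x hx
      rw [LinearMap.mem_ker] at hx ⊢
      have := LinearMap.congr_fun (hX n) x
      simp only [Module.End.mul_apply] at this
      rw [this, hx, map_zero]) with h1 | h1
    · exact h1
    · exact absurd (LinearMap.ker_eq_top.1 h1) hX0
  have hu : IsUnit X := (LinearMap.isUnit_iff_ker_eq_bot X).2 hker
  obtain ⟨u, rfl⟩ := hu
  have := h.1
  have hd : 0 < finrank ℂ W := finrank_pos
  have hdet : LinearMap.det (u : Module.End ℂ W) ≠ 0 := by
    have := u.isUnit.map (LinearMap.det : Module.End ℂ W →* ℂ)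
    exact this.ne_zero
  obtain ⟨z, hz⟩ := IsAlgClosed.exists_pow_nat_eq (LinearMap.det (u : Module.End ℂ W)) hd
  have hz0 : z ≠ 0 := by
    rintro rfl
    rw [zero_pow hd.ne'] at hz
    exact hdet hz.symm
  have hi : Twist σ r (↑u⁻¹ : Module.End ℂ W) := by
    simpa using hX.inv u.mul_inv u.inv_mul
  refine ⟨z • (↑u⁻¹ : Module.End ℂ W), z⁻¹ • (u : Module.End ℂ W), Or.inr ⟨hi.smul z, hX.smul _, ?_, ?_, ?_⟩⟩
  · rw [smul_mul_smul_comm, mul_inv_cancel₀ hz0, u.inv_mul, one_smul]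
  · rw [smul_mul_smul_comm, inv_mul_cancel₀ hz0, u.mul_inv, one_smul]
  · rw [LinearMap.det_smul, hz, ← map_mul, u.mul_inv, map_one]

end twist

section homs

/-- Equivariant maps as a subspace. -/
def HomN {H A B : Type*} [Group H] [AddCommGroup A] [Module ℂ A] [AddCommGroup B] [Module ℂ B]
    (α : Representation ℂ H A) (β : Representation ℂ H B) : Submodule ℂ (A →ₗ[ℂ] B) where
  carrier := {f | ∀ n, f ∘ₗ α n = β n ∘ₗ f}
  zero_mem' := by intro n; simp
  add_mem' := by
    intro f g hf hg n
    rw [LinearMap.add_comp, hf n, hg n, LinearMap.comp_add]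
  smul_mem' := by
    intro c f hf n
    rw [LinearMap.smul_comp, hf n, LinearMap.comp_smul]

/-- Averaging gives an equivariant map. -/
theorem average_mem {H A B : Type*} [Group H] [Fintype H] [AddCommGroup A] [Module ℂ A]
    [AddCommGroup B] [Module ℂ B]
    (α : Representation ℂ H A) (β : Representation ℂ H B) (p : A →ₗ[ℂ] B) :
    (∑ h : H, β h ∘ₗ p ∘ₗ α h⁻¹) ∈ HomN α β := by
  intro n
  ext x
  simp only [LinearMap.comp_apply, LinearMap.sum_apply, map_sum]
  rw [← Equiv.sum_comp (Equiv.mulLeft n)]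
  refine Finset.sum_congr rfl fun h _ => ?_
  have h1 : α (n * h)⁻¹ (α n x) = α h⁻¹ x := by
    rw [← Module.End.mul_apply, ← map_mul]
    congr 2
    simp
  rw [Equiv.coe_mulLeft, h1, map_mul, Module.End.mul_apply]

/-- An injective equivariant map has an equivariant left inverse. -/
theorem exists_leftInverse {H A B : Type*} [Group H] [Finite H] [AddCommGroup A] [Module ℂ A]
    [AddCommGroup B] [Module ℂ B]
    (α : Representation ℂ H A) (β : Representation ℂ H B) (f : A →ₗ[ℂ] B) (hf : f ∈ HomN α β)
    (hinj : LinearMap.ker f = ⊥) : ∃ p ∈ HomN β α, p ∘ₗ f = LinearMap.id := by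
  obtain ⟨p, hp⟩ := LinearMap.exists_leftInverse_of_injective f hinj
  have := Fintype.ofFinite H
  have hc : (Fintype.card H : ℂ) ≠ 0 := by exact_mod_cast Fintype.card_ne_zero
  refine ⟨(Fintype.card H : ℂ)⁻¹ • ∑ h : H, α h ∘ₗ p ∘ₗ β h⁻¹,
    Submodule.smul_mem _ _ (average_mem β α p), ?_⟩
  have hsc : (∑ h : H, α h ∘ₗ p ∘ₗ β h⁻¹) ∘ₗ f = ∑ h : H, (α h ∘ₗ p ∘ₗ β h⁻¹) ∘ₗ f := by
    ext x; simp
  rw [LinearMap.smul_comp, hsc, Finset.sum_congr rfl (g := fun _ => LinearMap.id)]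
  · rw [Finset.sum_const, Finset.card_univ, ← Nat.cast_smul_eq_nsmul ℂ, smul_smul,
      inv_mul_cancel₀ hc, one_smul]
  · intro h _
    rw [LinearMap.comp_assoc, LinearMap.comp_assoc, ← hf, ← LinearMap.comp_assoc (α h⁻¹) f p, hp,
      LinearMap.id_comp, ← Module.End.mul_eq_comp, ← map_mul, mul_inv_cancel, map_one]
    rfl

end homs

section key
variable {G W V : Type*} [Group G] {N : Subgroup G} [N.Normal] [AddCommGroup W] [Module ℂ W]
  [AddCommGroup V] [Module ℂ V] {σ : Representation ℂ N W} {ρ : Representation ℂ G V}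

/-- The restriction of a representation to a subgroup. -/
abbrev res (ρ : Representation ℂ G V) (N : Subgroup G) : Representation ℂ N V := ρ.comp N.subtype

theorem homN_apply {f : W →ₗ[ℂ] V} (hf : f ∈ HomN σ (res ρ N)) (n : N) (w : W) :
    f (σ n w) = ρ n (f w) := LinearMap.congr_fun (hf n) w

theorem homN'_apply {p : V →ₗ[ℂ] W} (hp : p ∈ HomN (res ρ N) σ) (n : N) (v : V) :
    p (ρ n v) = σ n (p v) := LinearMap.congr_fun (hp n) v

theorem Twist.apply {r : G} {X : Module.End ℂ W} (hX : Twist σ r X) (n : N) (w : W) :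
    X (σ n w) = σ (MulAut.conjNormal r n) (X w) := LinearMap.congr_fun (hX n) w

/-- The operator `f ↦ r f X` on equivariant maps. -/
def opU (ρ : Representation ℂ G V) (r : G) (X : Module.End ℂ W) (hX : Twist σ r⁻¹ X) :
    Module.End ℂ (HomN σ (res ρ N)) where
  toFun f := ⟨ρ r ∘ₗ f.1 ∘ₗ X, by
    intro n
    ext w
    simp only [LinearMap.comp_apply, MonoidHom.comp_apply, Subgroup.subtype_apply]
    rw [hX.apply, homN_apply f.2, ← Module.End.mul_apply, ← Module.End.mul_apply, ← map_mul,
      ← map_mul]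
    congr 2
    simp [mul_assoc]⟩
  map_add' f g := by ext; simp
  map_smul' c f := by ext; simp

theorem opU_apply (r : G) (X : Module.End ℂ W) (hX : Twist σ r⁻¹ X) (f : HomN σ (res ρ N)) (w : W) :
    (opU ρ r X hX f).1 w = ρ r (f.1 (X w)) := rfl

theorem opU_eq_zero (r : G) (hX : Twist σ r⁻¹ 0) : opU ρ r 0 hX = 0 := by
  ext f w; simp [opU_apply]

theorem opU_ext {r s : G} {X Y : Module.End ℂ W} (hX : Twist σ r⁻¹ X) (hY : Twist σ s⁻¹ Y)
    (h1 : r = s) (h2 : X = Y) : opU ρ r X hX = opU ρ s Y hY := by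
  subst h1 h2; rfl

theorem opU_smul (r : G) (X : Module.End ℂ W) (hX : Twist σ r⁻¹ X) (c : ℂ) :
    opU ρ r (c • X) (hX.smul c) = c • opU ρ r X hX := by
  ext f w; simp [opU_apply]

theorem twist_mul_inv {r s : G} {X Y : Module.End ℂ W} (hX : Twist σ r⁻¹ X) (hY : Twist σ s⁻¹ Y) :
    Twist σ (r * s)⁻¹ (Y * X) := by
  rw [mul_inv_rev]; exact hY.mul hX

theorem opU_mul {r s : G} {X Y : Module.End ℂ W} (hX : Twist σ r⁻¹ X) (hY : Twist σ s⁻¹ Y) :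
    opU ρ r X hX * opU ρ s Y hY = opU ρ (r * s) (Y * X) (twist_mul_inv hX hY) := by
  ext f w; simp [opU_apply]

theorem opU_pow {r : G} {X : Module.End ℂ W} (hX : Twist σ r⁻¹ X) (k : ℕ) :
    opU ρ r X hX ^ k = opU ρ (r ^ k) (X ^ k) (by rw [← inv_pow]; exact hX.pow k) := by
  induction k with
  | zero => ext f w; simp [opU_apply]
  | succ k ih => 
    rw [pow_succ', ih, opU_mul]
    exact opU_ext _ _ (pow_succ' _ _).symm (pow_succ _ _).symm

/-- moving an element of `N` across -/
theorem opU_move {r : G} {X : Module.End ℂ W} (n : N) (hX : Twist σ (r * n)⁻¹ X) :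
    ∃ h : Twist σ r⁻¹ (σ n * X), opU ρ (r * n) X hX = opU ρ r (σ n * X) h := by
  have h : Twist σ r⁻¹ (σ n * X) := by
    have := (twist_self (σ := σ) n).mul hX
    simpa using this
  refine ⟨h, ?_⟩
  ext f w
  simp only [opU_apply, map_mul, Module.End.mul_apply]
  rw [homN_apply f.2]

variable [FiniteDimensional ℂ W] [FiniteDimensional ℂ V] [Finite G]

theorem isIntegral_of_pow_eq_det {d : ℕ} (hd : 0 < d) (μ : ℂ) (n : N)
    (h : μ ^ d = LinearMap.det (σ n)) : IsIntegral ℤ μ := by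
  refine IsIntegral.of_pow hd ?_
  rw [h]
  refine IsIntegral.of_pow (Nat.card_pos (α := N)) ?_
  rw [← map_pow, ← map_pow, pow_card_eq_one', map_one, map_one]
  exact isIntegral_one

/-- The (normalized) pairing. -/
noncomputable def pair (ρ : Representation ℂ G V) (σ : Representation ℂ N W) :
    HomN (res ρ N) σ →ₗ[ℂ] Module.Dual ℂ (HomN σ (res ρ N)) :=
  LinearMap.mk₂ ℂ (fun p f => LinearMap.trace ℂ W (p.1 ∘ₗ f.1) / finrank ℂ W)
    (by intro p p' f; simp [LinearMap.add_comp, add_div])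
    (by intro c p f; simp [LinearMap.smul_comp, mul_div_assoc])
    (by intro p f f'; simp [LinearMap.comp_add, add_div])
    (by intro c p f; simp [LinearMap.comp_smul, mul_div_assoc])

theorem pair_spec (h : Irr σ) (p : HomN (res ρ N) σ) (f : HomN σ (res ρ N)) :
    p.1 ∘ₗ f.1 = pair ρ σ p f • (1 : Module.End ℂ W) := by
  refine twist_scalar h (X := p.1 ∘ₗ f.1) ?_
  intro n
  ext w
  simp only [Module.End.mul_apply, LinearMap.comp_apply, homN_apply f.2, homN'_apply p.2]
  simp

theorem pair_surjective (h : Irr σ) : Function.Surjective (pair ρ σ) := by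
  rw [← LinearMap.range_eq_top]
  suffices hb : (LinearMap.range (pair ρ σ)).dualCoannihilator = ⊥ by
    rw [← Subspace.dualCoannihilator_dualAnnihilator_eq (W := LinearMap.range (pair ρ σ)), hb,
      Submodule.dualAnnihilator_bot]
  rw [eq_bot_iff]
  intro f hf
  rw [Submodule.mem_dualCoannihilator] at hf
  by_contra hf0
  have hf1 : f.1 ≠ 0 := fun h0 => hf0 (by simpa using Subtype.ext h0)
  have hk : LinearMap.ker f.1 = ⊥ := by
    rcases h.2 (LinearMap.ker f.1) (by
      intro n x hx
      rw [LinearMap.mem_ker] at hx ⊢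
      rw [homN_apply f.2, hx, map_zero]) with h1 | h1
    · exact h1
    · exact absurd (LinearMap.ker_eq_top.1 h1) hf1
  obtain ⟨p, hp, hpf⟩ := exists_leftInverse σ (res ρ N) f.1 f.2 hk
  have h1 := hf (pair ρ σ ⟨p, hp⟩) (LinearMap.mem_range_self _ _)
  have h2 := pair_spec h ⟨p, hp⟩ f
  rw [h1, zero_smul] at h2
  simp only [hpf] at h2
  have := h.1
  exact one_ne_zero (α := Module.End ℂ W) h2

theorem sum_conj (hV : Irr ρ) (hW : Irr σ) (p : HomN (res ρ N) σ) (f : HomN σ (res ρ N)) :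
    ∑ᶠ q : G ⧸ N, (ρ q.out ∘ₗ (f.1 ∘ₗ p.1) ∘ₗ ρ q.out⁻¹) =
      ((N.index * finrank ℂ W / finrank ℂ V : ℂ) * pair ρ σ p f) • (1 : Module.End ℂ V) := by
  have := Fintype.ofFinite (G ⧸ N)
  rw [finsum_eq_sum_of_fintype]
  set F : G → Module.End ℂ V := fun g => ρ g * (f.1 ∘ₗ p.1) * ρ g⁻¹ with hF
  have hinv : ∀ g (n : N), F (g * n) = F g := by
    intro g n
    ext v
    simp only [hF, map_mul, mul_inv_rev, Module.End.mul_apply, LinearMap.comp_apply]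
    have h1 : ((n : G)⁻¹) = ((n⁻¹ : N) : G) := rfl
    rw [← homN_apply f.2, h1, homN'_apply p.2, ← Module.End.mul_apply (σ n), ← map_mul,
      mul_inv_cancel, map_one, Module.End.one_apply]
  have hout : ∀ g : G, F ((g : G ⧸ N).out) = F g := by
    intro g
    obtain ⟨n, hn⟩ := QuotientGroup.mk_out_eq_mul N g
    rw [hn, hinv]
  set S : Module.End ℂ V := ∑ q : G ⧸ N, F q.out with hS
  have hcomm : ∀ g, S * ρ g = ρ g * S := by
    intro g
    rw [hS, Finset.sum_mul, Finset.mul_sum, ← Equiv.sum_comp (MulAction.toPerm g)]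
    refine Finset.sum_congr rfl fun q _ => ?_
    induction q using QuotientGroup.induction_on with
    | H x =>
      have : (MulAction.toPerm g) (x : G ⧸ N) = ((g * x : G) : G ⧸ N) := rfl
      rw [this, hout, hout]
      simp only [hF, map_mul, mul_inv_rev, mul_assoc]
      rw [← map_mul ρ g⁻¹ g, inv_mul_cancel, map_one, mul_one]
  have h1 := schur_trace hV S hcomm
  have h2 : LinearMap.trace ℂ V S = N.index * (finrank ℂ W * pair ρ σ p f) := by
    rw [hS, map_sum, Finset.sum_congr rfl (g := fun _ => (finrank ℂ W * pair ρ σ p f : ℂ))]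
    · rw [Finset.sum_const, Finset.card_univ, nsmul_eq_mul, Subgroup.index, Nat.card_eq_fintype_card]
    · intro q _
      simp only [hF]
      rw [LinearMap.trace_mul_comm, ← mul_assoc, ← map_mul, inv_mul_cancel, map_one, one_mul,
        LinearMap.trace_comp_comm', pair_spec hW, map_smul, LinearMap.trace_one, smul_eq_mul,
        mul_comm]
  calc _ = S := rfl
    _ = _ := h1
    _ = _ := by rw [h2]; congr 1; ring

theorem key (hV : Irr ρ) (hW : Irr σ) (f0 : W →ₗ[ℂ] V) (hf0 : f0 ∈ HomN σ (res ρ N))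
    (hne : f0 ≠ 0) : finrank ℂ V ∣ N.index * finrank ℂ W := by
  have := Fintype.ofFinite (G ⧸ N)
  have := hV.1
  have := hW.1
  have hdV : (finrank ℂ V : ℂ) ≠ 0 := by exact_mod_cast (finrank_pos (R := ℂ) (M := V)).ne'
  have hdW : 0 < finrank ℂ W := finrank_pos
  choose a a' haa using fun q : G ⧸ N => twist_dichotomy hW q.out
  have htz : ∀ r, Twist σ r 0 := by intro r n; simp
  have ha : ∀ q : G ⧸ N, Twist σ (q.out⁻¹)⁻¹ (a q) := by
    intro q
    rw [inv_inv]
    rcases haa q with h | h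
    · rw [h.1]; exact htz _
    · exact h.1
  have ha' : ∀ q : G ⧸ N, Twist σ (q.out)⁻¹ (a' q) := by
    intro q
    rcases haa q with h | h
    · rw [h.2.1]; exact htz _
    · exact h.2.1
  let b : G ⧸ N → Module.End ℂ (HomN σ (res ρ N)) := fun q => opU ρ q.out (a' q) (ha' q)
  let d : G ⧸ N → Module.End ℂ (HomN σ (res ρ N)) := fun q => opU ρ q.out⁻¹ (a q) (ha q)
  set lam : ℂ := N.index * finrank ℂ W / finrank ℂ V with hlam
  -- multiplicativity
  have hmul : ∀ q q', ∃ c : ℂ, IsIntegral ℤ c ∧ b q * b q' = c • b (q * q') := by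
    intro q q'
    obtain ⟨n, hn⟩ := QuotientGroup.mk_out_eq_mul N (q.out * q'.out)
    have hq : ((q.out * q'.out : G) : G ⧸ N) = q * q' := by
      simp
    rw [hq] at hn
    have hr : q.out * q'.out = (q * q').out * ((n⁻¹ : N) : G) := by rw [hn]; simp
    have h1 : b q * b q' = opU ρ ((q * q').out * ((n⁻¹ : N) : G)) (a' q' * a' q)
        (hr ▸ twist_mul_inv (ha' q) (ha' q')) := by
      simp only [b]
      rw [opU_mul]
      exact opU_ext _ _ hr rfl
    obtain ⟨hZ, h2⟩ := opU_move (ρ := ρ) (n⁻¹) (hr ▸ twist_mul_inv (ha' q) (ha' q'))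
    rw [h2] at h1
    by_cases hz : σ n⁻¹ * (a' q' * a' q) = 0
    · refine ⟨0, isIntegral_zero, ?_⟩
      rw [h1, opU_ext hZ (htz _) rfl hz, opU_eq_zero, zero_smul]
    rcases haa (q * q') with h | h
    · exact absurd (h.2.2 _ hZ) hz
    have hq1 : LinearMap.det (a' q) = 1 := by
      rcases haa q with h | h
      · exact absurd (by rw [h.2.1, mul_zero, mul_zero]) hz
      · have := congrArg LinearMap.det h.2.2.1
        rwa [map_mul, h.2.2.2.2, one_mul, map_one] at this
    have hq2 : LinearMap.det (a' q') = 1 := by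
      rcases haa q' with h | h
      · exact absurd (by rw [h.2.1, zero_mul, mul_zero]) hz
      · have := congrArg LinearMap.det h.2.2.1
        rwa [map_mul, h.2.2.2.2, one_mul, map_one] at this
    have hq3 : LinearMap.det (a' (q * q')) = 1 := by
      have := congrArg LinearMap.det h.2.2.1
      rwa [map_mul, h.2.2.2.2, one_mul, map_one] at this
    have hs := twist_scalar hW (X := σ n⁻¹ * (a' q' * a' q) * a (q * q'))
      (by simpa using hZ.mul h.1)
    set μ := (LinearMap.trace ℂ W (σ n⁻¹ * (a' q' * a' q) * a (q * q')) / finrank ℂ W : ℂ) with hμ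
    have hs2 : σ n⁻¹ * (a' q' * a' q) = μ • a' (q * q') := by
      have := congrArg (· * a' (q * q')) hs
      simp only [mul_assoc, h.2.2.1, mul_one, smul_mul_assoc, one_mul] at this
      exact this
    refine ⟨μ, ?_, ?_⟩
    · refine isIntegral_of_pow_eq_det (σ := σ) hdW μ n⁻¹ ?_
      have := congrArg LinearMap.det hs2
      rw [map_mul, map_mul, hq1, hq2, LinearMap.det_smul, hq3] at this
      simpa using this.symm
    · rw [h1, opU_ext hZ ((ha' _).smul μ) rfl hs2, opU_smul]
  -- trace integrality
  have htr : ∀ q, IsIntegral ℤ (LinearMap.trace ℂ _ (d q)) := by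
    intro q
    rcases haa q with h | h
    · have : d q = 0 := by
        simp only [d]
        rw [opU_ext (ha q) (htz _) rfl h.1, opU_eq_zero]
      rw [this, map_zero]; exact isIntegral_zero
    · have hk : 0 < Nat.card G := Nat.card_pos
      refine isIntegral_trace_of_pow (d q) (Nat.card G * finrank ℂ W) (by positivity) ?_
      have h1 : q.out⁻¹ ^ Nat.card G = 1 := pow_card_eq_one'
      have h2 := twist_scalar hW (X := a q ^ Nat.card G)
        (by simpa [pow_card_eq_one'] using h.1.pow (Nat.card G))
      set μ := (LinearMap.trace ℂ W (a q ^ Nat.card G) / finrank ℂ W : ℂ) with hμ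
      have h3 : μ ^ finrank ℂ W = 1 := by
        have := congrArg LinearMap.det h2
        rw [map_pow, h.2.2.2.2, one_pow, LinearMap.det_smul, map_one, mul_one] at this
        exact this.symm
      have h4 : a q ^ (Nat.card G * finrank ℂ W) = 1 := by
        rw [pow_mul, h2, smul_pow, h3, one_pow, one_smul]
      have h5 : q.out⁻¹ ^ (Nat.card G * finrank ℂ W) = 1 := by rw [pow_mul, h1, one_pow]
      simp only [d]
      rw [opU_pow]
      ext f w
      simp only [opU_apply, h4, h5]
      simp
  -- the main relation
  have hrel : ∀ (l : Module.Dual ℂ (HomN σ (res ρ N))) (f f' : HomN σ (res ρ N)),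
      ∑ q, l (d q f') • b q f = (lam * l f) • f' := by
    intro l f f'
    obtain ⟨p, rfl⟩ := pair_surjective hW l
    have h1 := sum_conj hV hW p f
    rw [finsum_eq_sum_of_fintype] at h1
    have key1 : ∀ q : G ⧸ N, p.1 ∘ₗ ρ q.out⁻¹ ∘ₗ f'.1 = pair ρ σ p (d q f') • a' q := by
      intro q
      have hX : Twist σ q.out⁻¹ (p.1 ∘ₗ ρ q.out⁻¹ ∘ₗ f'.1) := by
        intro n
        ext w
        simp only [Module.End.mul_apply, LinearMap.comp_apply]
        rw [homN_apply f'.2, ← homN'_apply p.2, ← Module.End.mul_apply, ← Module.End.mul_apply,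
          ← map_mul, ← map_mul]
        congr 3
        simp [mul_assoc]
      rcases haa q with h | h
      · rw [h.2.2 _ hX, h.2.1, smul_zero]
      · have h2 : (p.1 ∘ₗ ρ q.out⁻¹ ∘ₗ f'.1) * a q = pair ρ σ p (d q f') • 1 := by
          rw [← pair_spec hW]; rfl
        have h3 := congrArg (· * a' q) h2
        simp only [mul_assoc, h.2.2.1, mul_one, smul_mul_assoc, one_mul] at h3
        exact h3
    ext w
    have h2 := LinearMap.congr_fun h1 (f'.1 w)
    simp only [LinearMap.sum_apply, LinearMap.comp_apply, LinearMap.smul_apply,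
      Module.End.one_apply] at h2
    simp only [Submodule.coe_sum, Submodule.coe_smul, LinearMap.sum_apply, LinearMap.smul_apply]
    rw [← h2]
    refine Finset.sum_congr rfl fun q _ => ?_
    have h3 := LinearMap.congr_fun (key1 q) w
    simp only [LinearMap.comp_apply, LinearMap.smul_apply] at h3
    rw [h3, map_smul, map_smul]
    rfl
  have hsum : ∑ q, LinearMap.trace ℂ _ (d q) • b q = lam • 1 := by
    ext1 f
    let B := Module.finBasis ℂ (HomN σ (res ρ N))
    have h1 : ∀ q, LinearMap.trace ℂ _ (d q) = ∑ i, B.coord i (d q (B i)) := by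
      intro q
      rw [LinearMap.trace_eq_matrix_trace ℂ B, Matrix.trace]
      simp [LinearMap.toMatrix_apply]
    simp only [LinearMap.sum_apply, LinearMap.smul_apply, Module.End.one_apply, h1,
      Finset.sum_smul]
    rw [Finset.sum_comm, Finset.sum_congr rfl fun i _ => hrel (B.coord i) f (B i)]
    simp only [mul_smul, ← Finset.smul_sum, Module.Basis.coord_apply, B.sum_repr]
  -- integrality
  have hU : Nontrivial (HomN σ (res ρ N)) := ⟨⟨f0, hf0⟩, 0, fun h => hne (congrArg Subtype.val h)⟩
  have hidx : N.index ≠ 0 := Subgroup.index_ne_zero_of_finite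
  have hlam0 : lam ≠ 0 := by
    rw [hlam]
    have : (N.index : ℂ) ≠ 0 := by exact_mod_cast hidx
    have : (finrank ℂ W : ℂ) ≠ 0 := by exact_mod_cast hdW.ne'
    positivity
  let A := integralClosure ℤ ℂ
  let L : Submodule A (Module.End ℂ (HomN σ (res ρ N))) := Submodule.span A (Set.range b)
  have hmemL : ∀ (c : ℂ), IsIntegral ℤ c → ∀ x ∈ L, c • x ∈ L := by
    intro c hc x hx
    exact L.smul_mem (⟨c, hc⟩ : A) hx
  have hlamA : IsIntegral A lam := by
    refine isIntegral_of_smul_mem_submodule (M := Module.End ℂ (HomN σ (res ρ N))) L ?_ ?_ lam ?_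
    · intro hbot
      have hb : ∀ q, b q = 0 := by
        intro q
        have : b q ∈ L := Submodule.subset_span ⟨q, rfl⟩
        rw [hbot] at this
        simpa using this
      simp only [hb, smul_zero, Finset.sum_const_zero] at hsum
      rcases smul_eq_zero.1 hsum.symm with h | h
      · exact hlam0 h
      · exact one_ne_zero h
    · exact Submodule.fg_span (Set.finite_range b)
    · intro x hx
      induction hx using Submodule.span_induction with
      | mem x hx =>
        obtain ⟨q', rfl⟩ := hx
        have h1 : lam • b q' = (∑ q, LinearMap.trace ℂ _ (d q) • b q) * b q' := by
          rw [hsum, smul_mul_assoc, one_mul]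
        rw [h1, Finset.sum_mul]
        refine Submodule.sum_mem _ fun q _ => ?_
        rw [smul_mul_assoc]
        apply hmemL _ (htr q)
        obtain ⟨c, hc, hc'⟩ := hmul q q'
        rw [hc']
        exact hmemL c hc _ (Submodule.subset_span ⟨_, rfl⟩)
      | zero => rw [smul_zero]; exact L.zero_mem
      | add x y _ _ hx hy => rw [smul_add]; exact L.add_mem hx hy
      | smul c x _ hx => rw [smul_comm]; exact L.smul_mem c hx
  have hlamZ : IsIntegral ℤ lam := isIntegral_trans lam hlamA
  have hq : lam = algebraMap ℚ ℂ (N.index * finrank ℂ W / finrank ℂ V : ℚ) := by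
    simp [hlam]
  rw [hq, isIntegral_algebraMap_iff (algebraMap ℚ ℂ).injective] at hlamZ
  obtain ⟨z, hz⟩ := IsIntegrallyClosed.isIntegral_iff.1 hlamZ
  have hdV' : (finrank ℂ V : ℚ) ≠ 0 := by exact_mod_cast (finrank_pos (R := ℂ) (M := V)).ne'
  rw [eq_div_iff hdV'] at hz
  have hz2 : (z * finrank ℂ V : ℤ) = ((N.index * finrank ℂ W : ℕ) : ℤ) := by
    rw [eq_intCast] at hz
    exact_mod_cast hz
  rw [← Int.natCast_dvd_natCast, ← hz2]
  exact dvd_mul_left _ _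

end key

section internal
variable {G V : Type*} [Group G] [AddCommGroup V] [Module ℂ V]

/-- `Y` is stable under `H`. -/
def InvS (ρ : Representation ℂ G V) (H : Subgroup G) (Y : Submodule ℂ V) : Prop :=
  ∀ h ∈ H, ∀ y ∈ Y, ρ h y ∈ Y

/-- `Y` is an irreducible `H`-submodule. -/
def IrrS (ρ : Representation ℂ G V) (H : Subgroup G) (Y : Submodule ℂ V) : Prop :=
  Y ≠ ⊥ ∧ InvS ρ H Y ∧ ∀ X ≤ Y, InvS ρ H X → X = ⊥ ∨ X = Y

/-- Restriction to a stable subspace along a homomorphism. -/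
def subRep {K : Type*} [Group K] (ρ : Representation ℂ G V) (φ : K →* G) (Y : Submodule ℂ V)
    (h : ∀ k, ∀ y ∈ Y, ρ (φ k) y ∈ Y) : Representation ℂ K Y where
  toFun k := (ρ (φ k)).restrict (h k)
  map_one' := by ext; simp
  map_mul' k l := by ext; simp

theorem subRep_coe {K : Type*} [Group K] (ρ : Representation ℂ G V) (φ : K →* G)
    (Y : Submodule ℂ V) (h : ∀ k, ∀ y ∈ Y, ρ (φ k) y ∈ Y) (k : K) (y : Y) :
    (subRep ρ φ Y h k y : V) = ρ (φ k) y := rfl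

theorem irr_subRep {K : Type*} [Group K] {ρ : Representation ℂ G V} {φ : K →* G}
    {Y : Submodule ℂ V} (h : ∀ k, ∀ y ∈ Y, ρ (φ k) y ∈ Y) {H : Subgroup G} (hH : φ.range = H)
    (hY : IrrS ρ H Y) : Irr (subRep ρ φ Y h) := by
  refine ⟨Submodule.nontrivial_iff_ne_bot.2 hY.1, fun X hX => ?_⟩
  have h1 := hY.2.2 (X.map Y.subtype) (Submodule.map_subtype_le _ _) (by
    rintro g hg _ ⟨x, hx, rfl⟩
    rw [← hH] at hg
    obtain ⟨k, rfl⟩ := hg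
    exact ⟨_, hX k x hx, rfl⟩)
  rcases h1 with h1 | h1
  · left
    rw [eq_bot_iff]
    intro x hx
    have h2 : (x : V) ∈ X.map Y.subtype := ⟨x, hx, rfl⟩
    rw [h1] at h2
    simpa using h2
  · right
    rw [eq_top_iff]
    intro y _
    have : (y : V) ∈ X.map Y.subtype := by rw [h1]; exact y.2
    obtain ⟨x, hx, hxy⟩ := this
    have : x = y := Subtype.ext hxy
    rwa [← this]

theorem map_irrS {ρ : Representation ℂ G V} [FiniteDimensional ℂ V] {M : Subgroup G}
    {Z : Submodule ℂ V} (hZ : IrrS ρ M Z)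
    (T : Module.End ℂ V) (hT : ∀ m ∈ M, ∀ v, T (ρ m v) = ρ m (T v)) (hne : Z.map T ≠ ⊥) :
    IrrS ρ M (Z.map T) ∧ finrank ℂ (Z.map T) = finrank ℂ Z := by
  have hk : Z ⊓ LinearMap.ker T = ⊥ := by
    rcases hZ.2.2 (Z ⊓ LinearMap.ker T) inf_le_left (by
      rintro m hm z ⟨hz1, hz2⟩
      refine ⟨hZ.2.1 m hm z hz1, ?_⟩
      have hz2' : T z = 0 := hz2
      change T (ρ m z) = 0
      rw [hT m hm, hz2', map_zero]) with h | h
    · exact h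
    · exfalso
      apply hne
      rw [eq_bot_iff]
      rintro _ ⟨z, hz, rfl⟩
      rw [← h] at hz
      exact hz.2
  refine ⟨⟨hne, ?_, ?_⟩, ?_⟩
  · rintro m hm _ ⟨z, hz, rfl⟩
    exact ⟨_, hZ.2.1 m hm z hz, hT m hm z⟩
  · intro X hX hXi
    rcases hZ.2.2 (Z ⊓ X.comap T) inf_le_left (by
      rintro m hm z ⟨hz1, hz2⟩
      refine ⟨hZ.2.1 m hm z hz1, ?_⟩
      change T (ρ m z) ∈ X
      rw [hT m hm]
      exact hXi m hm _ hz2) with h | h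
    · left
      rw [eq_bot_iff]
      intro x hx
      obtain ⟨z, hz, rfl⟩ := hX hx
      have : z ∈ Z ⊓ X.comap T := ⟨hz, hx⟩
      rw [h] at this
      have hz0 : z = 0 := by simpa using this
      simp [hz0]
    · right
      refine le_antisymm hX ?_
      rintro _ ⟨z, hz, rfl⟩
      have hz' := hz
      rw [SetLike.mem_coe, ← h] at hz'
      exact hz'.2
  · have h1 : Z.map T = LinearMap.range (T.domRestrict Z) := by
      ext x; simp [LinearMap.domRestrict_apply]
    rw [h1]
    apply LinearMap.finrank_range_of_inj
    rw [← LinearMap.ker_eq_bot, eq_bot_iff]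
    intro z hz
    have : (z : V) ∈ Z ⊓ LinearMap.ker T := ⟨z.2, hz⟩
    rw [hk] at this
    simpa using this

variable [FiniteDimensional ℂ V] [Finite G]

theorem keyS {ρ : Representation ℂ G V} {H N : Subgroup G} (hNH : N ≤ H)
    (hn : (N.subgroupOf H).Normal) {Y Z : Submodule ℂ V} (hY : IrrS ρ H Y) (hZ : IrrS ρ N Z)
    (hZY : Z ≤ Y) : finrank ℂ Y ∣ N.relIndex H * finrank ℂ Z := by
  have i1 := irr_subRep (φ := H.subtype) (fun k => hY.2.1 k k.2) (by simp) hY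
  have i2 := irr_subRep (φ := H.subtype.comp (N.subgroupOf H).subtype)
    (fun k => hZ.2.1 _ (Subgroup.mem_subgroupOf.1 k.2)) (by
      rw [MonoidHom.range_comp, Subgroup.range_subtype, Subgroup.subgroupOf_map_subtype,
        inf_eq_left.2 hNH]) hZ
  refine key i1 i2 (Submodule.inclusion hZY) ?_ ?_
  · intro n
    ext z
    rfl
  · intro h0
    apply hZ.1
    rw [eq_bot_iff]
    intro z hz
    have := LinearMap.congr_fun h0 ⟨z, hz⟩
    simpa using congrArg Subtype.val this

theorem descent {ρ : Representation ℂ G V} {K M : Subgroup G} (hMK : M ≤ K) (d : ℕ) :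
    ∀ (n : ℕ) (Y Z : Submodule ℂ V), finrank ℂ Y ≤ n → InvS ρ K Y → Z ≤ Y → IrrS ρ M Z →
      finrank ℂ Z = d →
      ∃ Y' ≤ Y, IrrS ρ K Y' ∧ ∃ Z' ≤ Y', IrrS ρ M Z' ∧ finrank ℂ Z' = d := by
  intro n
  induction n with
  | zero =>
    intro Y Z hn hY hZY hZ hd
    exfalso
    apply hZ.1
    have : Y = ⊥ := Submodule.finrank_eq_zero.1 (by omega)
    rwa [this, le_bot_iff] at hZY
  | succ n ih =>
    intro Y Z hn hY hZY hZ hd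
    by_cases hirr : IrrS ρ K Y
    · exact ⟨Y, le_rfl, hirr, Z, hZY, hZ, hd⟩
    have hY0 : Y ≠ ⊥ := by
      rintro rfl
      exact hZ.1 (le_bot_iff.1 hZY)
    have hX : ∃ X ≤ Y, InvS ρ K X ∧ X ≠ ⊥ ∧ X ≠ Y := by
      by_contra hcon
      push Not at hcon
      refine hirr ⟨hY0, hY, fun X hX hi => ?_⟩
      by_cases h0 : X = ⊥
      · exact Or.inl h0
      · exact Or.inr (hcon X hX hi h0)
    obtain ⟨X, hXY, hXi, hX0, hXY'⟩ := hX
    obtain ⟨p, hp, hpX⟩ := exists_leftInverse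
      (subRep ρ K.subtype X (fun k => hXi k k.2)) (res ρ K) X.subtype
      (by intro k; ext x; rfl) (by simp)
    let P : Module.End ℂ V := X.subtype ∘ₗ p
    have hP : ∀ k ∈ K, ∀ v, P (ρ k v) = ρ k (P v) := by
      intro k hk v
      have := LinearMap.congr_fun (hp ⟨k, hk⟩) v
      exact congrArg Subtype.val this
    have hlt : ∀ Y1 : Submodule ℂ V, Y1 ≤ Y → Y1 ≠ Y → finrank ℂ Y1 ≤ n := by
      intro Y1 h1 h2
      have := Submodule.finrank_lt_finrank_of_lt (lt_of_le_of_ne h1 h2)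
      omega
    by_cases hPZ : Z.map P = ⊥
    · have hZk : Z ≤ LinearMap.ker P := by
        intro z hz
        have : P z ∈ Z.map P := ⟨z, hz, rfl⟩
        rw [hPZ] at this
        simpa using this
      obtain ⟨Y', hY', h⟩ := ih (Y ⊓ LinearMap.ker P) Z (hlt _ inf_le_left (by
        intro hh
        apply hX0
        rw [eq_bot_iff]
        intro x hx
        have h1 : x ∈ Y ⊓ LinearMap.ker P := by rw [hh]; exact hXY hx
        have h2 : P x = 0 := h1.2
        have h3 := congrArg Subtype.val (LinearMap.congr_fun hpX ⟨x, hx⟩)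
        have h4 : P x = x := h3
        rw [h2] at h4
        simp [← h4])) (by
          rintro k hk y ⟨hy1, hy2⟩
          refine ⟨hY k hk y hy1, ?_⟩
          have hy2' : P y = 0 := hy2
          change P (ρ k y) = 0
          rw [hP k hk, hy2', map_zero]) (le_inf hZY hZk) hZ hd
      exact ⟨Y', hY'.trans inf_le_left, h⟩
    · obtain ⟨h1, h2⟩ := map_irrS hZ P (fun m hm => hP m (hMK hm)) hPZ
      obtain ⟨Y', hY', h⟩ := ih X (Z.map P) (hlt _ hXY hXY') hXi (by
        rintro _ ⟨z, hz, rfl⟩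
        exact (p z).2) h1 (h2.trans hd)
      exact ⟨Y', hY'.trans hXY, h⟩

theorem chain_dvd {ρ : Representation ℂ G V} (n : ℕ) : ∀ (c : Fin (n + 1) → Subgroup G),
    (∀ i : Fin n, c i.castSucc ≤ c i.succ ∧ ((c i.castSucc).subgroupOf (c i.succ)).Normal) →
    c 0 ≤ c (Fin.last n) ∧ ∀ Y Z : Submodule ℂ V, IrrS ρ (c (Fin.last n)) Y → IrrS ρ (c 0) Z →
      Z ≤ Y → finrank ℂ Y ∣ (c 0).relIndex (c (Fin.last n)) * finrank ℂ Z := by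
  induction n with
  | zero =>
    intro c hc
    refine ⟨le_rfl, fun Y Z hY hZ hZY => ?_⟩
    rcases hY.2.2 Z hZY hZ.2.1 with h | h
    · exact absurd h hZ.1
    · rw [h]; exact dvd_mul_left _ _
  | succ n ih =>
    intro c hc
    obtain ⟨h1, h2⟩ := ih (fun i => c i.castSucc) (fun i => hc i.castSucc)
    obtain ⟨h3, h4⟩ := hc (Fin.last n)
    rw [Fin.succ_last] at h3 h4
    rw [Fin.castSucc_zero] at h1 h2
    refine ⟨h1.trans h3, fun Y Z hY hZ hZY => ?_⟩
    obtain ⟨Y', hY', hI, Z', hZ', hIZ, hd⟩ := descent (ρ := ρ) (M := c 0) h1 (finrank ℂ Z) _ Y Z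
      le_rfl (fun h hh => hY.2.1 h (h3 hh)) hZY hZ rfl
    have e1 := keyS h3 h4 hY hI hY'
    have e2 := h2 Y' Z' hI hIZ hZ'
    rw [hd] at e2
    rw [← Subgroup.relIndex_mul_relIndex _ _ _ h1 h3]
    refine e1.trans ?_
    rw [mul_comm (Subgroup.relIndex (c 0) _), mul_assoc]
    exact mul_dvd_mul_left _ e2

theorem deg_dvd {ρ : Representation ℂ G V} (hρ : Irr ρ) (N : Subgroup G) [N.Normal]
    (hN : ∀ n ∈ N, ρ n = 1) : finrank ℂ V ∣ N.index := by
  have := hρ.1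
  obtain ⟨v, hv⟩ := exists_ne (0 : V)
  have h1 : Irr (1 : Representation ℂ N ℂ) :=
    ⟨inferInstance, fun X _ => eq_bot_or_eq_top X⟩
  have := key hρ h1 (LinearMap.toSpanSingleton ℂ V v) (by
    intro n
    ext
    simp [hN n n.2]) (by
    intro h
    apply hv
    have := LinearMap.congr_fun h 1
    simpa using this)
  simpa using this

open scoped ComplexOrder in
theorem trace_inv (ρ : Representation ℂ G V) (g : G) :
    LinearMap.trace ℂ V (ρ g⁻¹) = starRingEnd ℂ (LinearMap.trace ℂ V (ρ g)) := by
  have := Fintype.ofFinite G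
  let B := Module.finBasis ℂ V
  let A : G → Matrix (Fin (finrank ℂ V)) (Fin (finrank ℂ V)) ℂ := fun h => LinearMap.toMatrix B B (ρ h)
  have hA : ∀ x y, A (x * y) = A x * A y := by
    intro x y
    simp only [A, map_mul, LinearMap.toMatrix_mul]
  have hA1 : A 1 = 1 := by simp only [A, map_one, LinearMap.toMatrix_one]
  let P := ∑ h : G, (A h).conjTranspose * A h
  have hP : P.PosDef := by
    have : P = (A 1).conjTranspose * A 1 +
        ∑ h ∈ Finset.univ.erase 1, (A h).conjTranspose * A h := by
      exact (Finset.add_sum_erase Finset.univ (fun h => (A h).conjTranspose * A h)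
        (Finset.mem_univ 1)).symm
    rw [this, hA1, Matrix.conjTranspose_one, one_mul]
    exact Matrix.PosDef.one.add_posSemidef
      (Matrix.posSemidef_sum _ fun h _ => Matrix.posSemidef_conjTranspose_mul_self _)
  have hU : IsUnit P := hP.isUnit
  have hrel : P * A g⁻¹ = (A g).conjTranspose * P := by
    simp only [P, Finset.sum_mul, Finset.mul_sum]
    rw [← Equiv.sum_comp (Equiv.mulRight g)]
    refine Finset.sum_congr rfl fun h _ => ?_
    simp only [Equiv.coe_mulRight, hA, Matrix.conjTranspose_mul, mul_assoc]
    rw [← hA g, mul_inv_cancel, hA1, mul_one]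
  obtain ⟨u, hu⟩ := hU
  rw [← hu] at hrel
  have h2 : A g⁻¹ = (↑u⁻¹ : Matrix _ _ ℂ) * ((A g).conjTranspose * (u : Matrix _ _ ℂ)) := by
    rw [← hrel, Units.inv_mul_cancel_left]
  rw [LinearMap.trace_eq_matrix_trace ℂ B, LinearMap.trace_eq_matrix_trace ℂ B (ρ g)]
  change (A g⁻¹).trace = starRingEnd ℂ (A g).trace
  rw [h2, Matrix.trace_mul_comm, mul_assoc, Units.mul_inv, mul_one, Matrix.trace_conjTranspose]
  rfl

end internal

theorem irr_of_simple {G : Type} [Group G] (V : FDRep ℂ G) (hV : Simple V) : Irr V.ρ := by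
  constructor
  · by_contra h
    rw [not_nontrivial_iff_subsingleton] at h
    apply id_nonzero V
    ext x
    exact Subsingleton.elim _ _
  · intro X hX
    by_cases h0 : X = ⊥
    · exact Or.inl h0
    right
    let ρX : Representation ℂ G X := subRep V.ρ (MonoidHom.id G) X hX
    let ι : FDRep.of ρX ⟶ V := ⟨FGModuleCat.ofHom X.subtype, by
      intro g
      ext x
      rfl⟩
    have hmono : Mono ι := by
      constructor
      intro W a b hab
      ext x
      have h1 := congrArg (fun t : W ⟶ V => t.hom x) hab
      exact h1
    have hne : ι ≠ 0 := by
      intro h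
      apply h0
      rw [eq_bot_iff]
      intro x hx
      have h1 := congrArg (fun t : FDRep.of ρX ⟶ V => t.hom (⟨x, hx⟩ : X)) h
      exact h1
    have hiso : IsIso ι := (Simple.mono_isIso_iff_nonzero ι).2 hne
    have e := FDRep.isoToLinearEquiv (asIso ι)
    exact Submodule.eq_top_of_finrank_eq e.finrank_eq

theorem mem_charKer {G : Type} [Group G] (V : FDRep ℂ G) (g : G) :
    g ∈ V.charKer ↔ V.ρ g = 1 := by
  unfold FDRep.charKer
  rw [MonoidHom.mem_ker, ← Units.val_inj]
  rfl

theorem charKer_normal {G : Type} [Group G] (V : FDRep ℂ G) : V.charKer.Normal :=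
  MonoidHom.normal_ker _

theorem sup_normal_step {G : Type*} [Group G] {A B K : Subgroup G} [hK : K.Normal] (h : A ≤ B)
    (hn : (A.subgroupOf B).Normal) :
    A ⊔ K ≤ B ⊔ K ∧ ((A ⊔ K).subgroupOf (B ⊔ K)).Normal := by
  refine ⟨sup_le_sup_right h K, ⟨?_⟩⟩
  rintro ⟨n, hnB⟩ hn1 ⟨g, hg⟩
  rw [Subgroup.mem_subgroupOf] at hn1 ⊢
  change n ∈ A ⊔ K at hn1
  change g * n * g⁻¹ ∈ A ⊔ K
  obtain ⟨b, hb, k, hk, rfl⟩ := Subgroup.mem_sup_of_normal_right.1 hg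
  have hkS : k ∈ A ⊔ K := Subgroup.mem_sup_right hk
  have h1 : k * n * k⁻¹ ∈ A ⊔ K := mul_mem (mul_mem hkS hn1) (inv_mem hkS)
  obtain ⟨a, ha, l, hl, hal⟩ := Subgroup.mem_sup_of_normal_right.1 h1
  have h2 : b * k * n * (b * k)⁻¹ = (b * a * b⁻¹) * (b * l * b⁻¹) := by
    have : b * k * n * (b * k)⁻¹ = b * (k * n * k⁻¹) * b⁻¹ := by group
    rw [this, ← hal]; group
  rw [h2]
  refine mul_mem (Subgroup.mem_sup_left ?_) (Subgroup.mem_sup_right (hK.conj_mem l hl b))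
  exact hn.conj_mem ⟨a, h ha⟩ (Subgroup.mem_subgroupOf.2 ha) ⟨b, hb⟩

theorem exists_hom {G : Type} [Group G] [Fintype G] (M : Subgroup G) (V : FDRep ℂ G)
    (phi : FDRep ℂ M)
    (hconst : (∑ m : M, V.character (m : G) * starRingEnd ℂ (phi.character m)) ≠ 0) :
    ∃ f : phi →ₗ[ℂ] V, f ≠ 0 ∧ ∀ m x, f (phi.ρ m x) = V.ρ (m : G) (f x) := by
  have e : (∑ m : M, V.character (m : G) * starRingEnd ℂ (phi.character m)) =
      ∑ m : M, (Representation.character (res V.ρ M)) m *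
        (Representation.character phi.ρ) m⁻¹ := by
    refine Finset.sum_congr rfl fun m _ => ?_
    have := trace_inv phi.ρ m
    change _ * starRingEnd ℂ (LinearMap.trace ℂ phi (phi.ρ m)) = _ * LinearMap.trace ℂ phi (phi.ρ m⁻¹)
    rw [this]
    rfl
  have hcard : (Nat.card M : ℂ) ≠ 0 := Nat.cast_ne_zero.2 Nat.card_pos.ne'
  letI := invertibleOfNonzero hcard
  have h := Representation.card_inv_mul_sum_char_mul_char_eq_finrank phi.ρ (res V.ρ M)
  rw [← e] at h
  have h1 : (finrank ℂ (Representation.IntertwiningMap phi.ρ (res V.ρ M)) : ℂ) ≠ 0 := by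
    rw [← h]
    exact mul_ne_zero (inv_ne_zero hcard) hconst
  have h2 : finrank ℂ (Representation.IntertwiningMap phi.ρ (res V.ρ M)) ≠ 0 := by
    exact_mod_cast h1
  have h3 : Nontrivial (Representation.IntertwiningMap phi.ρ (res V.ρ M)) :=
    Module.nontrivial_of_finrank_pos (Nat.pos_of_ne_zero h2)
  obtain ⟨f, hf⟩ := exists_ne (0 : Representation.IntertwiningMap phi.ρ (res V.ρ M))
  refine ⟨f.toLinearMap, ?_, ?_⟩
  · intro h0
    apply hf
    ext x
    exact LinearMap.congr_fun h0 x
  · intro m x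
    exact LinearMap.congr_fun (f.isIntertwining' m) x

theorem range_irrS {G : Type} [Group G] (M K : Subgroup G) [K.Normal] (V : FDRep ℂ G)
    (phi : FDRep ℂ M) (hphi : Irr phi.ρ) (hK : ∀ k ∈ K, V.ρ k = 1)
    (f : phi →ₗ[ℂ] V) (hf0 : f ≠ 0) (hf : ∀ m x, f (phi.ρ m x) = V.ρ (m : G) (f x)) :
    Function.Injective f ∧ IrrS V.ρ (M ⊔ K) (LinearMap.range f) := by
  have hinj : Function.Injective f := by
    rw [← LinearMap.ker_eq_bot]
    rcases hphi.2 (LinearMap.ker f) (by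
      intro m x hx
      have hx' : f x = 0 := hx
      change f (phi.ρ m x) = 0
      rw [hf, hx', map_zero]) with h | h
    · exact h
    · exact absurd (LinearMap.ker_eq_top.1 h) hf0
  refine ⟨hinj, ?_, ?_, ?_⟩
  · intro h
    exact hf0 (LinearMap.range_eq_bot.1 h)
  · rintro g hg _ ⟨x, rfl⟩
    obtain ⟨m, hm, k, hk, rfl⟩ := Subgroup.mem_sup_of_normal_right.1 hg
    refine ⟨phi.ρ ⟨m, hm⟩ x, ?_⟩
    rw [hf, map_mul, hK k hk, mul_one]
  · intro X hX hXi
    rcases hphi.2 (X.comap f) (by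
      intro m x hx
      change f (phi.ρ m x) ∈ X
      rw [hf]
      exact hXi _ (Subgroup.mem_sup_left m.2) _ hx) with h | h
    · left
      rw [eq_bot_iff]
      intro y hy
      obtain ⟨x, rfl⟩ := hX hy
      have : x ∈ X.comap f := hy
      rw [h] at this
      have hx0 : x = 0 := this
      rw [hx0, map_zero]
      exact zero_mem _
    · right
      refine le_antisymm hX ?_
      rintro _ ⟨x, rfl⟩
      have : x ∈ X.comap f := by rw [h]; trivial
      exact this

theorem arith {v w K j P r : ℕ} (hw : 0 < w) (hv : 0 < v) (h1 : v ∣ j * w) (h2 : v ∣ K) (h3 : w ∣ P)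
    (h4 : K = j * (r * P)) : P / w ∣ K / v := by
  obtain ⟨t, ht⟩ := h1
  obtain ⟨a, rfl⟩ := h2
  obtain ⟨b, rfl⟩ := h3
  rw [Nat.mul_div_cancel_left _ hv, Nat.mul_div_cancel_left _ hw]
  refine ⟨t * r, ?_⟩
  apply Nat.eq_of_mul_eq_mul_left hv
  calc v * a = (j * w) * (r * b) := by rw [h4]; ring
    _ = v * (b * (t * r)) := by rw [ht]; ring

end CodAux

/-- If `M` is subnormal in `G` and `φ` is an irreducible constituent of the restriction of
an irreducible character `χ` of `G` to `M`, then the codegree of `φ` divides that of `χ`. -/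
theorem codegree_constituent_dvd {G : Type} [Group G] [Fintype G]
    (M : Subgroup G) (hM : M.IsSubnormalIn)
    (V : FDRep ℂ G) (hV : Simple V)
    (phi : FDRep ℂ M) (hphi : Simple phi)
    (hconst : (∑ m : M, V.character (m : G) * starRingEnd ℂ (phi.character m)) ≠ 0) :
    phi.codegree ∣ V.codegree := by
  have hVi := CodAux.irr_of_simple V hV
  have hpi := CodAux.irr_of_simple phi hphi
  obtain ⟨n, c, hc0, hcl, hc⟩ := hM
  obtain ⟨f, hf0, hf⟩ := CodAux.exists_hom M V phi hconst
  have hKn : V.charKer.Normal := CodAux.charKer_normal V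
  have hPn : phi.charKer.Normal := CodAux.charKer_normal phi
  have hK1 : ∀ k ∈ V.charKer, V.ρ k = 1 := fun k hk => (CodAux.mem_charKer V k).1 hk
  obtain ⟨hinj, hZ⟩ := CodAux.range_irrS M V.charKer V phi hpi hK1 f hf0 hf
  have hVn := hVi.1
  have hpn := hpi.1
  have hchain := (CodAux.chain_dvd (ρ := V.ρ) n (fun i => c i ⊔ V.charKer)
    (fun i => CodAux.sup_normal_step (hc i).1 (hc i).2)).2 ⊤ (LinearMap.range f)
    (by
      refine ⟨top_ne_bot, fun _ _ _ _ => trivial, fun X _ hX => hVi.2 X fun g => hX g ?_⟩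
      simp [hcl])
    (by simpa only [hc0] using hZ) le_top
  simp only [hc0, hcl, top_sup_eq, Subgroup.relIndex_top_right, finrank_top,
    LinearMap.finrank_range_of_inj hinj] at hchain
  have hle : V.charKer.subgroupOf M ≤ phi.charKer := by
    intro m hm
    rw [CodAux.mem_charKer]
    refine LinearMap.ext fun x => hinj ?_
    rw [hf, hK1 _ (Subgroup.mem_subgroupOf.1 hm)]
    rfl
  have h4 : V.charKer.index = (M ⊔ V.charKer).index *
      ((V.charKer.subgroupOf M).relIndex phi.charKer * phi.charKer.index) := by
    rw [Subgroup.relIndex_mul_index hle, ← Subgroup.relIndex_mul_index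
      (le_sup_right : V.charKer ≤ M ⊔ V.charKer), Subgroup.relIndex_sup_right, mul_comm]
    rfl
  exact CodAux.arith finrank_pos finrank_pos hchain
    (CodAux.deg_dvd hVi V.charKer hK1)
    (CodAux.deg_dvd hpi phi.charKer fun k hk => (CodAux.mem_charKer phi k).1 hk) h4
end

section
/- Let G be a finite group with a normal abelian minimal normal subgroup N such that C_G(N) = N. If for every nontrivial irreducible character λ of N and every θ ∈ Irr(I_G(λ) | λ) the number |I_G(λ)|/θ(1) lies in cod(G), and cod(G/N) = cod(G), then |N| divides |G/N|. -/
open CategoryTheory Module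

/-- The inertia group `I_G(f)` of a class function `f` on a normal subgroup `N ⊴ G`. -/
def inertia {G : Type*} [Group G] (N : Subgroup G) (hN : N.Normal) (f : N → ℂ) :
    Subgroup G where
  carrier := {g | ∀ n : N, f ⟨g * n * g⁻¹, hN.conj_mem n n.2 g⟩ = f n}
  one_mem' := by
    intro n
    have : (⟨1 * (n : G) * 1⁻¹, hN.conj_mem n n.2 1⟩ : N) = n := Subtype.ext (by group)
    rw [this]
  mul_mem' := by
    intro a b ha hb n
    have h1 : (⟨a * b * (n : G) * (a * b)⁻¹, hN.conj_mem n n.2 (a * b)⟩ : N)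
        = ⟨a * ((⟨b * (n : G) * b⁻¹, hN.conj_mem n n.2 b⟩ : N) : G) * a⁻¹,
            hN.conj_mem _ (hN.conj_mem n n.2 b) a⟩ := Subtype.ext (by group)
    rw [h1, ha, hb]
  inv_mem' := by
    intro a ha n
    have h2 := ha ⟨a⁻¹ * (n : G) * a⁻¹⁻¹, hN.conj_mem n n.2 a⁻¹⟩
    have h3 : (⟨a * ((⟨a⁻¹ * (n : G) * a⁻¹⁻¹, hN.conj_mem n n.2 a⁻¹⟩ : N) : G) * a⁻¹,
        hN.conj_mem _ (hN.conj_mem n n.2 a⁻¹) a⟩ : N) = n := Subtype.ext (by group)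
    rw [h3] at h2
    exact h2.symm

attribute [local instance] Classical.propDecidable

/-- `N` is a minimal normal subgroup of `G`. -/
def IsMinimalNormal {G : Type*} [Group G] (N : Subgroup G) : Prop :=
  N.Normal ∧ N ≠ ⊥ ∧ ∀ K : Subgroup G, K.Normal → K ≤ N → K = ⊥ ∨ K = N

/-- Let `N` be an abelian minimal normal subgroup of `G` with `C_G(N) = N`. If for every
nontrivial irreducible character `λ` of `N` and every `θ ∈ Irr(I_G(λ) | λ)` the number
`|I_G(λ)|/θ(1)` lies in `cod(G)`, and `cod(G/N) = cod(G)`, then `|N|` divides `|G/N|`. -/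
lemma isIntegral_char {G : Type} [Group G] [Fintype G] (V : FDRep ℂ G) (g : G) :
    IsIntegral ℤ (V.character g) := by
  have hpow : (V.ρ g) ^ (orderOf g) = 1 := by rw [← map_pow, pow_orderOf_eq_one, map_one]
  have ht : V.character g = (LinearMap.charpoly (V.ρ g)).roots.sum := by
    unfold FDRep.character
    rw [LinearMap.trace_eq_matrix_trace ℂ (Module.finBasis ℂ V),
      Matrix.trace_eq_sum_roots_charpoly, LinearMap.charpoly_toMatrix]
  rw [ht]
  refine IsIntegral.multiset_sum fun x hx => ?_
  have hev : Module.End.HasEigenvalue (V.ρ g) x := by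
    rw [Module.End.hasEigenvalue_iff_isRoot_charpoly]
    exact Polynomial.isRoot_of_mem_roots hx
  obtain ⟨v, hv⟩ := hev.exists_hasEigenvector
  have h1 := hv.pow_apply (orderOf g)
  rw [hpow] at h1
  have hx1 : x ^ orderOf g = 1 := by
    have : (x ^ orderOf g - 1) • v = 0 := by
      rw [sub_smul, ← h1]; simp
    rcases smul_eq_zero.1 this with h | h
    · exact sub_eq_zero.1 h
    · exact absurd h hv.2
  refine IsIntegral.of_pow (orderOf_pos g) ?_
  rw [hx1]; exact isIntegral_one

lemma schur_scalar {G : Type} [Group G] [Fintype G] (V : FDRep ℂ G) [Simple V]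
    (A : V →ₗ[ℂ] V) (hA : ∀ g, A * V.ρ g = V.ρ g * A) : ∃ c : ℂ, A = c • 1 := by
  let f : V ⟶ V := ⟨FGModuleCat.ofHom A, fun g => by
    ext v
    exact LinearMap.congr_fun (hA g) v⟩
  obtain ⟨c, hc⟩ := endomorphism_simple_eq_smul_id ℂ f
  refine ⟨c, ?_⟩
  ext v
  have := congrArg (fun (k : V ⟶ V) => k.hom.hom.hom v) hc
  exact this.symm

lemma dvd_of_isIntegral (n d : ℕ) (s : ℂ) (hs : IsIntegral ℤ s) (h : s * d = n) (hn : n ≠ 0) :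
    d ∣ n := by
  have hd : (d : ℂ) ≠ 0 := by
    rintro h0; rw [h0, mul_zero] at h; exact hn (by exact_mod_cast h.symm)
  have hs' : s = algebraMap ℚ ℂ ((n : ℚ) / d) := by
    simp; rw [eq_div_iff hd, h]
  rw [hs', isIntegral_algebraMap_iff (algebraMap ℚ ℂ).injective,
    IsIntegrallyClosed.isIntegral_iff] at hs
  obtain ⟨y, hy⟩ := hs
  have hd' : (d : ℚ) ≠ 0 := by exact_mod_cast hd
  rw [eq_div_iff hd'] at hy
  have : y * (d : ℤ) = n := by
    simp at hy; exact_mod_cast hy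
  exact Int.natCast_dvd_natCast.1 ⟨y, by rw [← this, mul_comm]⟩

lemma finrank_dvd_index {G : Type} [Group G] [Fintype G] (V : FDRep ℂ G) [Simple V]
    (Z : Subgroup G) (lam : Z → ℂ) (h : ∀ z : Z, V.ρ z = lam z • 1) :
    finrank ℂ V ∣ Z.index := by
  classical
  let F : G → (V →ₗ[ℂ] V) := fun g => V.character g⁻¹ • V.ρ g
  have hF : ∀ (g : G) (z : Z), F (g * z) = F g := by
    intro g z
    have hz : lam z⁻¹ • lam z • (1 : V →ₗ[ℂ] V) = 1 := by
      have : V.ρ ((z⁻¹ : Z) : G) * V.ρ z = 1 := by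
        rw [← map_mul]; simp
      rw [h, h] at this
      rw [smul_comm]; simpa using this
    have hc : V.character (g * z)⁻¹ = lam z⁻¹ * V.character g⁻¹ := by
      unfold FDRep.character
      rw [mul_inv_rev, map_mul, ← Subgroup.coe_inv, h]
      simp
    simp only [F]
    rw [hc, map_mul, h]
    calc (lam z⁻¹ * V.character g⁻¹) • (V.ρ g * lam z • (1 : V →ₗ[ℂ] V))
        = V.character g⁻¹ • (V.ρ g * (lam z⁻¹ • lam z • (1 : V →ₗ[ℂ] V))) := by
          simp only [mul_smul_comm, mul_one, smul_smul]; congr 1; ring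
      _ = _ := by rw [hz, mul_one]
  let S : V →ₗ[ℂ] V := ∑ q : G ⧸ Z, F q.out
  have hsum : ∑ g : G, F g = (Nat.card Z : ℂ) • S := by
    have hbij : Function.Bijective (fun p : (G ⧸ Z) × Z => p.1.out * (p.2 : G)) := by
      constructor
      · rintro ⟨q, z⟩ ⟨q', z'⟩ hqq
        simp only at hqq
        have h3 : q = q' := by
          have := congrArg (QuotientGroup.mk (s := Z)) hqq
          rwa [QuotientGroup.mk_mul_of_mem _ z.2, QuotientGroup.mk_mul_of_mem _ z'.2,
            QuotientGroup.out_eq', QuotientGroup.out_eq'] at this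
        subst h3
        rw [Subtype.ext (mul_left_cancel hqq)]
      · intro g
        obtain ⟨w, hw⟩ := QuotientGroup.mk_out_eq_mul Z g
        exact ⟨(QuotientGroup.mk g, w⁻¹), by simp [hw]⟩
    rw [← Function.Bijective.sum_comp hbij, Fintype.sum_prod_type]
    have this (q : G ⧸ Z) (z : Z) : F (q.out * z) = F q.out := hF _ _
    simp only [this, S, Finset.sum_const, Finset.card_univ, Finset.smul_sum]
    simp [Nat.card_eq_fintype_card, Nat.cast_smul_eq_nsmul]
  have hcomm : ∀ x, S * V.ρ x = V.ρ x * S := by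
    intro x
    have hne : (Nat.card Z : ℂ) ≠ 0 := by exact_mod_cast Nat.card_pos.ne'
    apply smul_right_injective _ hne
    simp only
    rw [← smul_mul_assoc, ← mul_smul_comm, ← hsum, Finset.sum_mul, Finset.mul_sum,
      ← Equiv.sum_comp (MulAut.conj x).toEquiv]
    refine Finset.sum_congr rfl fun g _ => ?_
    simp only [F, MulEquiv.toEquiv_eq_coe, MulEquiv.coe_toEquiv, MulAut.conj_apply]
    have : (x * g * x⁻¹)⁻¹ = x * g⁻¹ * x⁻¹ := by group
    rw [this, FDRep.char_conj, smul_mul_assoc, mul_smul_comm, ← map_mul, ← map_mul]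
    simp
  obtain ⟨s, hs⟩ := schur_scalar V S hcomm
  have hnorm := (FDRep.simple_iff_char_is_norm_one V).1 inferInstance
  have htr : (Nat.card Z : ℂ) * (s * finrank ℂ V) = Nat.card G := by
    rw [← hnorm]
    have := congrArg (LinearMap.trace ℂ V) hsum
    rw [hs, map_sum] at this
    simp only [F, map_smul, LinearMap.trace_one, smul_eq_mul] at this
    rw [← this]
    refine Finset.sum_congr rfl fun g _ => ?_
    rw [mul_comm]; rfl
  have hmul : s * finrank ℂ V = Z.index := by
    have hne : (Nat.card Z : ℂ) ≠ 0 := by exact_mod_cast Nat.card_pos.ne'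
    apply mul_left_cancel₀ hne
    rw [htr]
    exact_mod_cast (Subgroup.card_mul_index Z).symm
  have hidx : Z.index ≠ 0 := Subgroup.index_ne_zero_of_finite
  refine dvd_of_isIntegral _ _ s ?_ hmul hidx
  -- integrality
  let R := integralClosure ℤ ℂ
  let φ : MonoidAlgebra R G →ₐ[R] (Module.End ℂ V) := MonoidAlgebra.lift R (Module.End ℂ V) G V.ρ
  let x : MonoidAlgebra R G :=
    ∑ q : G ⧸ Z, MonoidAlgebra.single q.out (⟨V.character q.out⁻¹, isIntegral_char V _⟩ : R)
  have hx : φ x = algebraMap ℂ (Module.End ℂ V) s := by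
    rw [Algebra.algebraMap_eq_smul_one]
    refine Eq.trans ?_ hs
    simp only [x, map_sum, S, φ, MonoidAlgebra.lift_single]
    rfl
  have hxi : IsIntegral R (φ x) := (IsIntegral.of_finite R x).map φ
  have : Nontrivial V := by
    by_contra hnt
    rw [not_nontrivial_iff_subsingleton] at hnt
    rw [finrank_zero_of_subsingleton] at hmul
    simp at hmul
    exact hidx (by exact_mod_cast hmul.symm)
  rw [hx, isIntegral_algebraMap_iff (FaithfulSMul.algebraMap_injective ℂ _)] at hxi
  exact isIntegral_trans (R := ℤ) s hxi

lemma exists_irred {G : Type} [Group G] (H : Subgroup G) (lam : H → ℂ) (n : ℕ) :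
    ∀ (V : Type) [AddCommGroup V] [Module ℂ V] [FiniteDimensional ℂ V] [Nontrivial V]
      (ρ : Representation ℂ G V), finrank ℂ V = n → (∀ z : H, ρ z = lam z • 1) →
    ∃ (W : Type) (_ : AddCommGroup W) (_ : Module ℂ W) (_ : FiniteDimensional ℂ W)
      (σ : Representation ℂ G W), σ.IsIrreducible ∧ (∀ z : H, σ z = lam z • 1) := by
  induction n using Nat.strong_induction_on with
  | _ n ih =>
    intro V _ _ _ _ ρ hn hρ
    by_cases hirr : ρ.IsIrreducible
    · exact ⟨V, _, _, inferInstance, ρ, hirr, hρ⟩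
    · have hnt : Nontrivial (Subrepresentation ρ) := by
        refine ⟨⊥, ⊤, fun h => ?_⟩
        obtain ⟨v, hv⟩ := exists_ne (0 : V)
        have h2 : (⊥ : Submodule ℂ V) = ⊤ := congrArg Subrepresentation.toSubmodule h
        exact bot_ne_top h2
      have : ∃ U : Subrepresentation ρ, U ≠ ⊥ ∧ U ≠ ⊤ := by
        by_contra hcon
        push Not at hcon
        exact hirr ⟨fun U => by by_cases hU : U = ⊥; exacts [Or.inl hU, Or.inr (hcon U hU)]⟩
      obtain ⟨U, hU1, hU2⟩ := this
      have hb : U.toSubmodule ≠ ⊥ := fun h => hU1 (Subrepresentation.toSubmodule_injective h)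
      have ht : U.toSubmodule ≠ ⊤ := fun h => hU2 (Subrepresentation.toSubmodule_injective h)
      have hlt : finrank ℂ U.toSubmodule < n := hn ▸ Submodule.finrank_lt ht
      have : Nontrivial U.toSubmodule := Submodule.nontrivial_iff_ne_bot.2 hb
      refine ih _ hlt U.toSubmodule U.toRepresentation rfl fun z => ?_
      ext v
      have := LinearMap.congr_fun (hρ z) v
      exact this

/-- functions transforming under left translation by `lam` -/
def semiInv {G : Type} [Group G] (H : Subgroup G) (lam : H →* ℂ) : Submodule ℂ (G → ℂ) where
  carrier := {f | ∀ (n : H) (x : G), f (n * x) = lam n * f x}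
  add_mem' := by
    intro a b ha hb n x
    simp only [Pi.add_apply, ha n x, hb n x, mul_add]
  zero_mem' := by intro n x; simp
  smul_mem' := by
    intro c a ha n x
    simp only [Pi.smul_apply, ha n x, smul_eq_mul]; ring

def semiRep {G : Type} [Group G] (H : Subgroup G) (lam : H →* ℂ) :
    Representation ℂ G (semiInv H lam) where
  toFun g :=
    { toFun := fun f => ⟨fun x => f.1 (x * g), fun n x => by
        simp only [mul_assoc]; exact f.2 n _⟩
      map_add' := fun _ _ => rfl
      map_smul' := fun _ _ => rfl }
  map_one' := by ext f x; simp
  map_mul' := by intro a b; ext f x; simp [mul_assoc]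

lemma exists_theta {G : Type} [Group G] [Fintype G] (H : Subgroup G) (hH : H.Normal)
    (lam : H →* ℂ) (hinv : ∀ (g : G) (n : H), lam ⟨g * n * g⁻¹, hH.conj_mem n n.2 g⟩ = lam n) :
    ∃ θ : FDRep ℂ G, Simple θ ∧ ∀ z : H, θ.ρ z = lam z • 1 := by
  classical
  have hnt : Nontrivial (semiInv H lam) := by
    rw [Submodule.nontrivial_iff_ne_bot]
    intro hbot
    let f : G → ℂ := fun x => if hx : x ∈ H then lam ⟨x, hx⟩ else 0
    have hf : f ∈ semiInv H lam := by
      intro n x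
      by_cases hx : x ∈ H
      · have hnx : (n : G) * x ∈ H := H.mul_mem n.2 hx
        simp only [f, dif_pos hx, dif_pos hnx, ← map_mul]; rfl
      · have hnx : (n : G) * x ∉ H := fun h => hx ((H.mul_mem_cancel_left n.2).1 h)
        simp only [f, dif_neg hx, dif_neg hnx, mul_zero]
    rw [hbot, Submodule.mem_bot] at hf
    have h1 := congrFun hf 1
    simp only [f, dif_pos H.one_mem] at h1
    have : lam ⟨1, H.one_mem⟩ = 1 := map_one lam
    rw [this] at h1
    exact one_ne_zero h1
  obtain ⟨W, _, _, _, σ, hσ, hs⟩ := exists_irred H lam _ (semiInv H lam) (semiRep H lam) rfl (by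
    intro z
    ext f x
    change f.1 (x * z) = lam z * f.1 x
    rw [← hinv x z, ← f.2]
    simp)
  refine ⟨FDRep.of σ, ?_, hs⟩
  rw [FDRep.simple_iff_char_is_norm_one]
  have := invertibleOfNonzero (NeZero.ne (Nat.card G : ℂ))
  have ho := Representation.char_orthonormal σ σ
  rw [if_pos ⟨Representation.Equiv.refl _⟩, inv_mul_eq_one₀ (NeZero.ne _)] at ho
  exact ho.symm

/-- Let `N` be an abelian minimal normal subgroup of `G` with `C_G(N) = N`. If for every
nontrivial irreducible character `λ` of `N` and every `θ ∈ Irr(I_G(λ) | λ)` the number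
`|I_G(λ)|/θ(1)` lies in `cod(G)`, and `cod(G/N) = cod(G)`, then `|N|` divides `|G/N|`. -/
theorem card_dvd_card_quotient {G : Type} [Group G] [Fintype G]
    (N : Subgroup G) (hN : N.Normal)
    (hab : ∀ a b : N, a * b = b * a)
    (hmin : IsMinimalNormal N)
    (hcent : Subgroup.centralizer (N : Set G) = N)
    (h1 : ∀ (lam : FDRep ℂ N), Simple lam → lam.charKer ≠ ⊤ →
      ∀ (hle : N ≤ inertia N hN lam.character)
        (θ : FDRep ℂ (inertia N hN lam.character)), Simple θ →
        (∑ n : N, θ.character (Subgroup.inclusion hle n)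
          * starRingEnd ℂ (lam.character n)) ≠ 0 →
        Nat.card (inertia N hN lam.character) / finrank ℂ θ ∈ codSet G)
    (h2 : codSet (G ⧸ N) = codSet G) :
    Nat.card N ∣ Nat.card (G ⧸ N) := by

  classical
  obtain ⟨-, hbot, -⟩ := hmin
  let _ : CommGroup N := { (inferInstance : Group N) with mul_comm := hab }
  have hex : ∃ a : N, a ≠ 1 := by
    by_contra hcon
    push Not at hcon
    exact hbot ((Subgroup.eq_bot_iff_forall N).2 fun x hx => congrArg Subtype.val (hcon ⟨x, hx⟩))
  obtain ⟨a, ha⟩ := hex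
  obtain ⟨φ, hφ⟩ := CommGroup.exists_apply_ne_one_of_hasEnoughRootsOfUnity N ℂ ha
  let l : N →* ℂ := (Units.coeHom ℂ).comp φ
  let lamρ : Representation ℂ N ℂ := (algebraMap ℂ (Module.End ℂ ℂ)).toMonoidHom.comp l
  let lam : FDRep ℂ N := FDRep.of lamρ
  have hchar : lam.character = l := by
    ext n
    change LinearMap.trace ℂ ℂ (algebraMap ℂ (Module.End ℂ ℂ) (l n)) = l n
    rw [Algebra.algebraMap_eq_smul_one, map_smul, LinearMap.trace_one]
    simp
  have hsimp : Simple lam := by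
    rw [FDRep.simple_iff_char_is_norm_one, hchar]
    have : ∀ g : N, l g * l g⁻¹ = 1 := fun g => by rw [← map_mul, mul_inv_cancel, map_one]
    rw [Finset.sum_congr rfl fun g _ => this g]
    simp
  have hker : lam.charKer ≠ ⊤ := by
    intro htop
    have hm : a ∈ lam.charKer := htop ▸ Subgroup.mem_top a
    have h3 : (Representation.asGroupHom lam.ρ) a = 1 := hm
    have h4 : lam.ρ a = 1 := congrArg Units.val h3
    have h5 : l a = 1 := by
      have h6 : lam.character a = lam.character 1 := by
        unfold FDRep.character; rw [h4, map_one lam.ρ]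
      rw [hchar, map_one] at h6
      exact h6
    exact hφ (Units.ext h5)
  have hle : N ≤ inertia N hN lam.character := by
    intro g hg n
    congr 1
    apply Subtype.ext
    have := congrArg Subtype.val (hab ⟨g, hg⟩ n)
    simp only [Subgroup.coe_mul] at this
    simp only [this, mul_inv_cancel_right]
  have key := h1 lam hsimp hker
  have hI : ∀ g ∈ inertia N hN lam.character, ∀ n : N,
      l ⟨g * n * g⁻¹, hN.conj_mem n n.2 g⟩ = l n := by
    intro g hg n
    have := hg n
    rwa [hchar] at this
  generalize inertia N hN lam.character = I at key hle hI
  let M : Subgroup I := N.subgroupOf I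
  have hM : M.Normal := hN.subgroupOf I
  let e : M ≃* N := Subgroup.subgroupOfEquivOfLe hle
  obtain ⟨θ, hθ, hsc⟩ := exists_theta M hM (l.comp e.toMonoidHom) (by
    intro g n
    exact hI g g.2 (e n))
  have hscN : ∀ n : N, θ.ρ (Subgroup.inclusion hle n) = l n • 1 := by
    intro n
    exact hsc ⟨Subgroup.inclusion hle n, n.2⟩
  have hd : finrank ℂ θ ∣ M.index := finrank_dvd_index θ M _ hsc
  have hd0 : finrank ℂ θ ≠ 0 := by
    rintro h0
    rw [h0] at hd
    exact Subgroup.index_ne_zero_of_finite (Nat.eq_zero_of_zero_dvd hd)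
  have hmem := key hle θ hθ (by
    have hn : ∀ n : N, ‖l n‖ = 1 := fun n => by
      have : l n ^ orderOf n = 1 := by rw [← map_pow, pow_orderOf_eq_one, map_one]
      exact Complex.norm_eq_one_of_pow_eq_one this (orderOf_pos n).ne'
    have : ∀ n : N, θ.character (Subgroup.inclusion hle n) * starRingEnd ℂ (lam.character n)
        = finrank ℂ θ := by
      intro n
      rw [hchar]
      unfold FDRep.character
      rw [hscN, map_smul, LinearMap.trace_one, smul_eq_mul, mul_right_comm, Complex.mul_conj,
        Complex.normSq_eq_norm_sq, hn]
      simp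
    simp only [this, Finset.sum_const, Finset.card_univ]
    simp [hd0])
  rw [← h2] at hmem
  obtain ⟨V, hV, hcod⟩ := hmem
  have hcardM : Nat.card M = Nat.card N := Nat.card_congr e.toEquiv
  have hNdvd : Nat.card N ∣ Nat.card I / finrank ℂ θ := by
    rw [← Subgroup.card_mul_index M, hcardM, Nat.mul_div_assoc _ hd]
    exact dvd_mul_right _ _
  have : Fintype (G ⧸ N) := Fintype.ofFinite _
  have hVd : finrank ℂ V ∣ V.charKer.index := by
    refine finrank_dvd_index V V.charKer (fun _ => 1) fun z => ?_
    have h3 : (Representation.asGroupHom V.ρ) z = 1 := z.2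
    have h4 : V.ρ z = 1 := congrArg Units.val h3
    rw [h4, one_smul]
  rw [← hcod] at hNdvd
  exact hNdvd.trans ((Nat.div_dvd_of_dvd hVd).trans V.charKer.index_dvd_card)
end
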